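/- arXiv:1710.11483 — 2 statements merged into one kernel-verified Lean document; each statement's English description precedes it below -/
import Mathlib

section
/- (Characterization of the space-time resonant set for 3D gravity-capillary waves.) Define Λ(ξ) := √(|ξ| + |ξ|³) for ξ ∈ ℝ² and Φ(ξ,η) := Λ(ξ) − Λ(η) − Λ(ξ−η). Let ξ, η ∈ ℝ² with η ≠ 0 and η ≠ ξ. Then Φ(ξ,η) = 0 and ∇_η Φ(ξ,η) = 0 hold simultaneously if and only if η = ξ/2 and |ξ| = √2. That is, the space-time resonant set is exactly {(ξ,η) ∈ ℝ² × ℝ² : |ξ| = √2, η = ξ/2}. -/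
/-- The gravity-capillary dispersion relation `Λ(ξ) = √(|ξ| + |ξ|³)` on `ℝ²`
(with `g = σ = 1`). -/
noncomputable def gcDisp (ξ : EuclideanSpace ℝ (Fin 2)) : ℝ :=
  Real.sqrt (‖ξ‖ + ‖ξ‖ ^ 3)

/-- The quadratic phase `Φ(ξ,η) = Λ(ξ) - Λ(η) - Λ(ξ-η)`. -/
noncomputable def gcPhase (ξ η : EuclideanSpace ℝ (Fin 2)) : ℝ :=
  gcDisp ξ - gcDisp η - gcDisp (ξ - η)

/-- The derivative of `√(r + r³)` divided by `r`: the coefficient `c(r)` such that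
`∇Λ(x) = c(‖x‖) x` away from the origin. -/
noncomputable def gcCoeff (r : ℝ) : ℝ :=
  (1 + 3 * r ^ 2) / (2 * Real.sqrt (r + r ^ 3)) / r

theorem gcCoeff_pos {r : ℝ} (hr : 0 < r) : 0 < gcCoeff r := by
  unfold gcCoeff
  positivity

theorem hasFDerivAt_norm_of_ne_zero {E : Type*} [NormedAddCommGroup E] [InnerProductSpace ℝ E]
    {x : E} (hx : x ≠ 0) :
    HasFDerivAt (fun y : E => ‖y‖) (‖x‖⁻¹ • innerSL ℝ x) x := by
  have h := (hasStrictFDerivAt_norm_sq x).hasFDerivAt.sqrt (by simpa using hx)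
  simp only [Real.sqrt_sq (norm_nonneg _)] at h
  convert h using 1
  ext v
  have : ‖x‖ ≠ 0 := norm_ne_zero_iff.mpr hx
  simp
  field_simp

theorem hasFDerivAt_gcDisp {x : EuclideanSpace ℝ (Fin 2)} (hx : x ≠ 0) :
    HasFDerivAt gcDisp (gcCoeff ‖x‖ • innerSL ℝ x) x := by
  have hr : 0 < ‖x‖ := norm_pos_iff.mpr hx
  have h1 : HasDerivAt (fun r : ℝ => Real.sqrt (r + r ^ 3))
      ((1 + 3 * ‖x‖ ^ 2) / (2 * Real.sqrt (‖x‖ + ‖x‖ ^ 3))) ‖x‖ := by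
    have h := ((hasDerivAt_id ‖x‖).add (hasDerivAt_pow 3 ‖x‖)).sqrt
      (by simp only [Pi.add_apply, id]; positivity)
    simpa using h
  have h2 := h1.comp_hasFDerivAt x (hasFDerivAt_norm_of_ne_zero hx)
  rw [smul_smul, ← div_eq_mul_inv] at h2
  exact h2

theorem fderiv_gcPhase_eq_zero_iff {ξ η : EuclideanSpace ℝ (Fin 2)} (hη : η ≠ 0) (hηξ : η ≠ ξ) :
    fderiv ℝ (fun η' => gcPhase ξ η') η = 0 ↔
      gcCoeff ‖η‖ • η = gcCoeff ‖ξ - η‖ • (ξ - η) := by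
  have hζ : ξ - η ≠ 0 := sub_ne_zero.mpr hηξ.symm
  have h1 := ((hasFDerivAt_gcDisp hη).const_sub (gcDisp ξ)).sub
    ((hasFDerivAt_gcDisp hζ).comp η ((hasFDerivAt_id η).const_sub ξ))
  have h2 : fderiv ℝ (fun η' => gcPhase ξ η') η =
      innerSL ℝ (gcCoeff ‖ξ - η‖ • (ξ - η) - gcCoeff ‖η‖ • η) := by
    refine HasFDerivAt.fderiv (h1.congr_fderiv ?_)
    ext v
    simp
    ring
  rw [h2]
  constructor
  · intro h
    have := congrArg norm h
    rw [innerSL_apply_norm, norm_zero, norm_eq_zero, sub_eq_zero] at this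
    exact this.symm
  · intro h
    rw [h, sub_self, map_zero]

theorem eq_of_sq_eqs {a b : ℝ} (ha : 0 < a) (hb : 0 < b)
    (h1 : 9 * (a * b) * (a + b) ^ 2 = 4 * ((1 + a ^ 2) * (1 + b ^ 2)))
    (h2 : (1 + 3 * a ^ 2) ^ 2 * (b + b ^ 3) = (1 + 3 * b ^ 2) ^ 2 * (a + a ^ 3)) : a = b := by
  by_contra hab
  obtain ⟨p, hp⟩ : ∃ p, p = a * b := ⟨_, rfl⟩
  obtain ⟨t, ht⟩ : ∃ t, t = (a + b) ^ 2 := ⟨_, rfl⟩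
  have hp0 : 0 < p := hp ▸ mul_pos ha hb
  have ht0 : 0 < t := by rw [ht]; positivity
  have htp : 4 * p ≤ t := by rw [hp, ht]; nlinarith [sq_nonneg (a - b)]
  have e1 : t * (9 * p - 4) = 4 * (1 - p) ^ 2 := by
    rw [hp, ht]; linear_combination h1
  have e2 : t * (9 * p - 1) = (1 - p) * (3 * p - 1) ^ 2 := by
    apply mul_left_cancel₀ (sub_ne_zero.mpr hab)
    rw [hp, ht]; linear_combination h2
  have hp4 : 4 ≤ 9 * p := by
    have : 0 ≤ t * (9 * p - 4) := by rw [e1]; positivity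
    linarith [nonneg_of_mul_nonneg_right this ht0]
  have hp1 : p < 1 := by
    by_contra hc
    have : 0 < t * (9 * p - 1) := mul_pos ht0 (by linarith)
    nlinarith [mul_nonneg (sub_nonneg.mpr (not_lt.mp hc)) (sq_nonneg (3 * p - 1))]
  have h5 : 4 * p * (9 * p - 1) ≤ t * (9 * p - 1) :=
    mul_le_mul_of_nonneg_right htp (by linarith)
  have h6 : (3 * p - 1) ^ 2 ≤ 4 := by nlinarith
  nlinarith [mul_le_mul_of_nonneg_left h6 (sub_nonneg.mpr hp1.le)]

theorem sq_eq_of_gcCoeff_mul_eq {a b : ℝ} (ha : 0 < a) (hb : 0 < b)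
    (h : gcCoeff a * a = gcCoeff b * b) :
    (1 + 3 * a ^ 2) ^ 2 * (b + b ^ 3) = (1 + 3 * b ^ 2) ^ 2 * (a + a ^ 3) := by
  unfold gcCoeff at h
  rw [div_mul_cancel₀ _ ha.ne', div_mul_cancel₀ _ hb.ne',
    div_eq_div_iff (by positivity) (by positivity)] at h
  have h' := congrArg (· ^ 2) h
  simp only [mul_pow] at h'
  rw [Real.sq_sqrt (by positivity), Real.sq_sqrt (by positivity)] at h'
  linarith

theorem sqrt_add_eq_iff {a b : ℝ} (ha : 0 < a) (hb : 0 < b) :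
    Real.sqrt ((a + b) + (a + b) ^ 3) = Real.sqrt (a + a ^ 3) + Real.sqrt (b + b ^ 3) ↔
      9 * (a * b) * (a + b) ^ 2 = 4 * ((1 + a ^ 2) * (1 + b ^ 2)) := by
  have hA := Real.sq_sqrt (show 0 ≤ a + a ^ 3 by positivity)
  have hB := Real.sq_sqrt (show 0 ≤ b + b ^ 3 by positivity)
  have hab : a * b ≠ 0 := (mul_pos ha hb).ne'
  have key : (2 * (Real.sqrt (a + a ^ 3) * Real.sqrt (b + b ^ 3))) ^ 2 =
      4 * ((a + a ^ 3) * (b + b ^ 3)) := by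
    rw [mul_pow, mul_pow, hA, hB]; ring
  rw [Real.sqrt_eq_iff_eq_sq (by positivity) (by positivity), add_sq, hA, hB]
  have step : (a + b + (a + b) ^ 3 = a + a ^ 3 + 2 * Real.sqrt (a + a ^ 3) *
      Real.sqrt (b + b ^ 3) + (b + b ^ 3)) ↔
      3 * (a * b) * (a + b) = 2 * (Real.sqrt (a + a ^ 3) * Real.sqrt (b + b ^ 3)) := by
    constructor <;> intro h <;> linear_combination h
  rw [step, ← sq_eq_sq₀ (by positivity) (by positivity), key]
  constructor
  · intro h
    apply mul_left_cancel₀ hab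
    linear_combination h
  · intro h
    linear_combination (a * b) * h

/-- **Characterization of the space-time resonant set for 3D gravity-capillary waves.**
For `η ≠ 0`, `η ≠ ξ`: `Φ(ξ,η) = 0` and `∇_η Φ(ξ,η) = 0` hold simultaneously iff
`η = ξ/2` and `‖ξ‖ = √2`. -/
theorem gc_space_time_resonant_set (ξ η : EuclideanSpace ℝ (Fin 2))
    (hη : η ≠ 0) (hηξ : η ≠ ξ) :
    (gcPhase ξ η = 0 ∧ fderiv ℝ (fun η' => gcPhase ξ η') η = 0) ↔
      (η = (1 / 2 : ℝ) • ξ ∧ ‖ξ‖ = Real.sqrt 2) := by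
  have hζ : ξ - η ≠ 0 := sub_ne_zero.mpr hηξ.symm
  rw [fderiv_gcPhase_eq_zero_iff hη hηξ]
  have ha : 0 < ‖η‖ := norm_pos_iff.mpr hη
  have hb : 0 < ‖ξ - η‖ := norm_pos_iff.mpr hζ
  constructor
  · rintro ⟨hΦ, hg⟩
    have hca := gcCoeff_pos ha
    have hcb := gcCoeff_pos hb
    have hn : gcCoeff ‖η‖ * ‖η‖ = gcCoeff ‖ξ - η‖ * ‖ξ - η‖ := by
      have := congrArg norm hg
      rwa [norm_smul, norm_smul, Real.norm_of_nonneg hca.le, Real.norm_of_nonneg hcb.le] at this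
    have hray : SameRay ℝ η (ξ - η) := Or.inr (Or.inr ⟨_, _, hca, hcb, hg⟩)
    have hξ : ‖ξ‖ = ‖η‖ + ‖ξ - η‖ := by
      rw [← hray.norm_add, add_sub_cancel]
    have h1 : 9 * (‖η‖ * ‖ξ - η‖) * (‖η‖ + ‖ξ - η‖) ^ 2 =
        4 * ((1 + ‖η‖ ^ 2) * (1 + ‖ξ - η‖ ^ 2)) := by
      rw [← sqrt_add_eq_iff ha hb, ← hξ]
      unfold gcPhase gcDisp at hΦ
      linarith
    have hab := eq_of_sq_eqs ha hb h1 (sq_eq_of_gcCoeff_mul_eq ha hb hn)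
    have hηζ : η = ξ - η := hray.eq_of_norm_eq hab
    refine ⟨?_, ?_⟩
    · rw [← eq_sub_iff_add_eq.mp hηζ]
      module
    · rw [hξ, eq_comm, Real.sqrt_eq_iff_mul_self_eq (by norm_num) (by positivity), ← hab]
      rw [← hab] at h1
      have : (2 * ‖η‖ ^ 2 - 1) * (4 * ‖η‖ ^ 2 + 1) = 0 := by linear_combination h1 / 4
      rcases mul_eq_zero.mp this with h | h
      · linear_combination (-2) * h
      · nlinarith
  · rintro ⟨hηe, hn⟩
    have hηζ : ξ - η = η := by rw [hηe]; module
    refine ⟨?_, by rw [hηζ]⟩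
    have hξ : ‖ξ‖ = ‖η‖ + ‖η‖ := by
      rw [hηe, norm_smul]; norm_num; ring
    have h2 : (‖η‖ + ‖η‖) ^ 2 = 2 := by
      rw [← hξ, hn, Real.sq_sqrt (by norm_num)]
    have h := (sqrt_add_eq_iff ha ha).mpr (by
      have : ‖η‖ ^ 2 = 1 / 2 := by linarith
      rw [← sq, h2, this]; norm_num)
    unfold gcPhase gcDisp
    rw [hηζ, hξ, h]
    ring
end

section
/- (Nondegeneracy of the space-time resonant points.) Define Λ(ξ) := √(|ξ| + |ξ|³) for ξ ∈ ℝ² and Φ(ξ,η) := Λ(ξ) − Λ(η) − Λ(ξ−η). For every ξ ∈ ℝ² with |ξ| = √2, the 2×2 matrix of second derivatives of the map η ↦ Φ(ξ,η) evaluated at the space-time resonant point η = ξ/2 is invertible (its determinant is nonzero). -/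
/-- The dispersion relation as a function of `s = |ξ|²`. -/
noncomputable def gcProfile (s : ℝ) : ℝ := √(√s * (1 + s))

/-- Twice the derivative of `gcProfile`. -/
noncomputable def gcSlope (s : ℝ) : ℝ := gcProfile s * ((1 + 3 * s) / (2 * s * (1 + s)))

/-- The differential of `gcDisp` away from the origin. -/
noncomputable def gcGrad (η : EuclideanSpace ℝ (Fin 2)) :
    EuclideanSpace ℝ (Fin 2) →L[ℝ] ℝ :=
  gcSlope (‖η‖ ^ 2) • innerSL ℝ η

lemma gcProfile_pos {s : ℝ} (hs : 0 < s) : 0 < gcProfile s := by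
  unfold gcProfile
  positivity

lemma gcDisp_eq_gcProfile (η : EuclideanSpace ℝ (Fin 2)) : gcDisp η = gcProfile (‖η‖ ^ 2) := by
  unfold gcDisp gcProfile
  rw [Real.sqrt_sq (norm_nonneg η)]
  ring_nf

lemma hasDerivAt_gcProfile {s : ℝ} (hs : 0 < s) :
    HasDerivAt gcProfile (gcSlope s / 2) s := by
  have h := (((Real.hasDerivAt_sqrt hs.ne').mul ((hasDerivAt_id s).const_add 1))).sqrt
    (by simp only [Pi.mul_apply, id]; positivity)
  refine h.congr_deriv ?_
  simp only [Pi.mul_apply, id, gcSlope, gcProfile]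
  have h1 : 0 < √s := Real.sqrt_pos.2 hs
  have h2 : 0 < √(√s * (1 + s)) := by positivity
  have e1 : √s ^ 2 = s := Real.sq_sqrt hs.le
  have e2 : √(√s * (1 + s)) ^ 2 = √s * (1 + s) := Real.sq_sqrt (by positivity)
  generalize √(√s * (1 + s)) = b at *
  generalize √s = a at *
  subst e1
  field_simp
  rw [e2]
  ring

lemma hasDerivAt_gcSlope_half :
    HasDerivAt gcSlope (-(19 / 18) * gcProfile (1 / 2)) (1 / 2) := by
  have hd := hasDerivAt_gcProfile (s := 1 / 2) (by norm_num)
  have hn : HasDerivAt (fun s : ℝ => 1 + 3 * s) (3 * 1) (1 / 2) :=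
    ((hasDerivAt_id' (1 / 2 : ℝ)).const_mul 3).const_add 1
  have hm : HasDerivAt (fun s : ℝ => 2 * s * (1 + s)) (2 * 1 * (1 + 1 / 2) + 2 * (1 / 2) * 1)
      (1 / 2) :=
    ((hasDerivAt_id' (1 / 2 : ℝ)).const_mul 2).mul ((hasDerivAt_id' (1 / 2 : ℝ)).const_add 1)
  have h := hd.mul (hn.div hm (by norm_num))
  refine h.congr_deriv ?_
  simp only [gcSlope, Pi.div_apply]
  ring

lemma hasFDerivAt_norm_sq (η : EuclideanSpace ℝ (Fin 2)) :
    HasFDerivAt (fun η : EuclideanSpace ℝ (Fin 2) => ‖η‖ ^ 2) (2 • innerSL ℝ η) η :=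
  (hasStrictFDerivAt_norm_sq η).hasFDerivAt

lemma hasFDerivAt_gcDisp_s8 {η : EuclideanSpace ℝ (Fin 2)} (hη : η ≠ 0) :
    HasFDerivAt gcDisp (gcGrad η) η := by
  have hs : 0 < ‖η‖ ^ 2 := by positivity
  have h := (hasDerivAt_gcProfile hs).comp_hasFDerivAt η (hasFDerivAt_norm_sq η)
  rw [funext gcDisp_eq_gcProfile]
  refine h.congr_fderiv ?_
  ext v
  simp [gcGrad]
  ring

lemma fderiv_gcPhase {ξ η : EuclideanSpace ℝ (Fin 2)} (hη : η ≠ 0) (hξη : ξ - η ≠ 0) :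
    fderiv ℝ (fun η => gcPhase ξ η) η = gcGrad (ξ - η) - gcGrad η := by
  have h1 := (hasFDerivAt_gcDisp_s8 hξη).comp η ((hasFDerivAt_id η).const_sub ξ)
  have h := ((hasFDerivAt_gcDisp_s8 hη).const_sub (gcDisp ξ)).sub h1
  refine (h.congr_fderiv ?_).fderiv
  ext v
  simp
  ring

/-- The real inner product as a continuous bilinear map. -/
noncomputable def gcInner :
    EuclideanSpace ℝ (Fin 2) →L[ℝ] EuclideanSpace ℝ (Fin 2) →L[ℝ] ℝ :=
  innerSL ℝ

lemma gcInner_apply (u v : EuclideanSpace ℝ (Fin 2)) : gcInner u v = inner ℝ u v := rfl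

lemma hasFDerivAt_gcGrad {η : EuclideanSpace ℝ (Fin 2)} (hη : ‖η‖ ^ 2 = 1 / 2) :
    HasFDerivAt gcGrad (gcSlope (1 / 2) • gcInner +
      ((-(19 / 18) * gcProfile (1 / 2)) • (2 • innerSL ℝ η)).smulRight (innerSL ℝ η)) η := by
  have hd := hasDerivAt_gcSlope_half
  rw [← hη] at hd ⊢
  exact (hd.comp_hasFDerivAt η (hasFDerivAt_norm_sq η)).smul
    gcInner.hasFDerivAt

/-- **Nondegeneracy of the space-time resonant points.**
For `‖ξ‖ = √2`, the second derivative (Hessian) of `η ↦ Φ(ξ,η)` at the space-time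
resonant point `η = ξ/2` is an invertible (injective, i.e. nonzero determinant)
linear map on `ℝ²`. -/
theorem gc_resonance_nondegenerate (ξ : EuclideanSpace ℝ (Fin 2))
    (hξ : ‖ξ‖ = Real.sqrt 2) :
    Function.Injective
      (fderiv ℝ (fderiv ℝ (fun η => gcPhase ξ η)) ((1 / 2 : ℝ) • ξ)) := by
  set η₀ : EuclideanSpace ℝ (Fin 2) := (1 / 2 : ℝ) • ξ with hη₀
  have hsub : ξ - η₀ = η₀ := by
    rw [hη₀]
    module
  have hnorm : ‖η₀‖ ^ 2 = 1 / 2 := by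
    rw [hη₀, norm_smul, hξ, mul_pow, Real.sq_sqrt (by norm_num)]
    norm_num
  have hne : η₀ ≠ 0 := by
    intro h
    norm_num [h] at hnorm
  have hev : fderiv ℝ (fun η => gcPhase ξ η) =ᶠ[nhds η₀]
      fun η => gcGrad (ξ - η) - gcGrad η := by
    have h1 : ∀ᶠ η in nhds η₀, η ≠ 0 := isOpen_ne.mem_nhds hne
    have h2 : ∀ᶠ η in nhds η₀, ξ - η ≠ 0 :=
      (continuous_const.sub continuous_id).continuousAt.eventually_ne (by simpa [hsub] using hne)
    filter_upwards [h1, h2] with η h1 h2 using fderiv_gcPhase h1 h2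
  have hW := hasFDerivAt_gcGrad hnorm
  have hW' := hW
  rw [← hsub] at hW'
  have hH := (hW'.comp η₀ ((hasFDerivAt_id η₀).const_sub ξ)).sub hW
  rw [hsub] at hH
  have hF := (hH.congr_of_eventuallyEq hev).fderiv
  rw [hF, injective_iff_map_eq_zero]
  intro u hu
  have hG : 0 < gcProfile (1 / 2) := gcProfile_pos (by norm_num)
  have hS : gcSlope (1 / 2) = 5 / 3 * gcProfile (1 / 2) := by
    unfold gcSlope
    ring
  have key : ∀ v : EuclideanSpace ℝ (Fin 2), 5 / 3 * inner ℝ u v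
      - 19 / 9 * inner ℝ η₀ u * inner ℝ η₀ v = 0 := by
    intro v
    have h := DFunLike.congr_fun hu v
    simp [hS, gcInner_apply, -one_div] at h
    have h' : gcProfile (1 / 2) * (5 / 3 * inner ℝ u v
      - 19 / 9 * inner ℝ η₀ u * inner ℝ η₀ v) = 0 := by
      linarith
    exact (mul_eq_zero.1 h').resolve_left hG.ne'
  have h1 := key η₀
  rw [real_inner_self_eq_norm_sq, hnorm, real_inner_comm] at h1
  have h0 : inner ℝ η₀ u = 0 := by linarith
  have h2 := key u
  rw [h0] at h2
  exact (inner_self_eq_zero (𝕜 := ℝ)).1 (by linarith)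
end
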